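/- arXiv:2304.03222 — 2 statements merged into one kernel-verified Lean document; each statement's English description precedes it below -/
import Mathlib

section
/- Let x⁰ ∈ ℝⁿ, Δ̄ > 0, and let f : ℝⁿ → ℝ be four times continuously differentiable on the open ball B(x⁰,Δ̄), with the third-derivative map x ↦ ∇³f(x) Lipschitz continuous with constant L ≥ 0 on the closed ball B̄(x⁰,Δ̄). Let S = [s¹ … s^m] ∈ ℝ^{n×m} and T̄ = [t¹ … t^k] ∈ ℝ^{n×k} have positive radii Δ_S and Δ_T, and assume the closed balls B̄(x⁰+s^i,Δ_T), B̄(x⁰−s^i,Δ_T) and B̄(x⁰,Δ_T) are contained in B(x⁰,Δ̄) for every i. Then, with no rank assumptions, ‖∇²_c f(x⁰;S,T̄) − Proj_{S,T̄} ∇²f(x⁰)‖ ≤ 2 √(mk) · L · (Δ_u/Δ_l) · ‖(Ŝᵀ)†‖ · ‖T̂†‖ · Δ_u², where Δ_u = max{Δ_S,Δ_T} and Δ_l = min{Δ_S,Δ_T}. -/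
open Matrix

noncomputable section

/-- `B` is the Moore–Penrose pseudoinverse of `A`: the four Penrose equations hold. -/
def IsMPInv {α β : Type*} [Fintype α] [Fintype β]
    (A : Matrix α β ℝ) (B : Matrix β α ℝ) : Prop :=
  A * B * A = A ∧ B * A * B = B ∧ (A * B)ᵀ = A * B ∧ (B * A)ᵀ = B * A

/-- the `j`-th column of a matrix, as a vector -/
def mcol {n m : Type*} (S : Matrix n m ℝ) (j : m) : n → ℝ := fun i => S i j

/-- `δ_s(x⁰;S)`, the vector of forward differences of `f` along the columns of `S` -/
def deltas {n m : Type*} (f : (n → ℝ) → ℝ) (x0 : n → ℝ) (S : Matrix n m ℝ) : m → ℝ :=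
  fun j => f (x0 + mcol S j) - f x0

/-- the generalized simplex gradient `∇_s f(x⁰;S) = (Sᵀ)† δ_s(x⁰;S)`;
here `Sp` stands for the pseudoinverse `(Sᵀ)†`. -/
def gsg {n m : Type*} [Fintype m] (f : (n → ℝ) → ℝ) (x0 : n → ℝ)
    (S Sp : Matrix n m ℝ) : n → ℝ :=
  Sp *ᵥ deltas f x0 S

/-- `δ²_s(x⁰;S,T_{1:m})`, whose `i`-th row is `(∇_s f(x⁰+s^i;T_i) − ∇_s f(x⁰;T_i))ᵀ`;
here `Tp i` stands for the pseudoinverse `((T i)ᵀ)†`. -/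
def delta2s {n m : Type*} {κ : m → Type*} [∀ i, Fintype (κ i)]
    (f : (n → ℝ) → ℝ) (x0 : n → ℝ) (S : Matrix n m ℝ)
    (T Tp : ∀ i, Matrix n (κ i) ℝ) : Matrix m n ℝ :=
  Matrix.of fun i j => gsg f (x0 + mcol S i) (T i) (Tp i) j - gsg f x0 (T i) (Tp i) j

/-- the generalized simplex Hessian `∇²_s f(x⁰;S,T_{1:m}) = (Sᵀ)† δ²_s(x⁰;S,T_{1:m})`;
here `Sp` stands for `(Sᵀ)†` and `Tp i` for `((T i)ᵀ)†`. -/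
def gsh {n m : Type*} [Fintype m] {κ : m → Type*} [∀ i, Fintype (κ i)]
    (f : (n → ℝ) → ℝ) (x0 : n → ℝ) (S Sp : Matrix n m ℝ)
    (T Tp : ∀ i, Matrix n (κ i) ℝ) : Matrix n n ℝ :=
  Sp * delta2s f x0 S T Tp

/-- the generalized centered simplex Hessian
`∇²_c f(x⁰;S,T_{1:m}) = ½(∇²_s f(x⁰;S,T_{1:m}) + ∇²_s f(x⁰;−S,−T_{1:m}))`,
using that `−A†` is the pseudoinverse of `−A`. -/
def gcsh {n m : Type*} [Fintype m] {κ : m → Type*} [∀ i, Fintype (κ i)]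
    (f : (n → ℝ) → ℝ) (x0 : n → ℝ) (S Sp : Matrix n m ℝ)
    (T Tp : ∀ i, Matrix n (κ i) ℝ) : Matrix n n ℝ :=
  (2⁻¹ : ℝ) • (gsh f x0 S Sp T Tp + gsh f x0 (-S) (-Sp) (fun i => -T i) (fun i => -Tp i))

/-- the Euclidean norm on `ℝ^n` -/
def vnorm {n : Type*} [Fintype n] (x : n → ℝ) : ℝ := Real.sqrt (∑ i, (x i) ^ 2)

/-- the open Euclidean ball -/
def vball {n : Type*} [Fintype n] (x : n → ℝ) (r : ℝ) : Set (n → ℝ) := {y | vnorm (y - x) < r}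

/-- the closed Euclidean ball -/
def vcball {n : Type*} [Fintype n] (x : n → ℝ) (r : ℝ) : Set (n → ℝ) := {y | vnorm (y - x) ≤ r}

/-- the operator 2-norm of a matrix -/
def opNorm {p q : Type*} [Fintype p] [Fintype q] (A : Matrix p q ℝ) : ℝ :=
  sSup {c | ∃ x : q → ℝ, vnorm x = 1 ∧ c = vnorm (A *ᵥ x)}

/-- the radius of a matrix: the largest Euclidean norm of a column -/
def mradius {n m : Type*} [Fintype n] (S : Matrix n m ℝ) : ℝ := ⨆ j, vnorm (mcol S j)

/-- the Hessian matrix of `f` at `x` -/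
def hess {n : Type*} [Fintype n] [DecidableEq n] (f : (n → ℝ) → ℝ) (x : n → ℝ) :
    Matrix n n ℝ :=
  Matrix.of fun i j => fderiv ℝ (fun y => fderiv ℝ f y (Pi.single j 1)) x (Pi.single i 1)

/-- the third order partial derivatives of `f` at `x`, as a trilinear tensor -/
def d3 {n : Type*} [Fintype n] [DecidableEq n] (f : (n → ℝ) → ℝ) (x : n → ℝ) :
    n → n → n → ℝ :=
  fun i j k =>
    fderiv ℝ
      (fun y => fderiv ℝ (fun z => fderiv ℝ f z (Pi.single k 1)) y (Pi.single j 1)) x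
      (Pi.single i 1)

/-- the (injective/operator) norm of a trilinear tensor, induced by the Euclidean norm -/
def t3norm {n : Type*} [Fintype n] (T : n → n → n → ℝ) : ℝ :=
  sSup {c | ∃ u v w : n → ℝ, vnorm u = 1 ∧ vnorm v = 1 ∧ vnorm w = 1 ∧
    c = |∑ i, ∑ j, ∑ k, T i j k * u i * v j * w k|}

/-- The Penrose equations determine the pseudoinverse. -/
lemma IsMPInv.unique {α β : Type*} [Fintype α] [Fintype β]
    {A : Matrix α β ℝ} {B C : Matrix β α ℝ} (hB : IsMPInv A B) (hC : IsMPInv A C) : B = C := by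
  obtain ⟨b1, b2, b3, b4⟩ := hB
  obtain ⟨c1, c2, c3, c4⟩ := hC
  have h1 : A * B = A * C := by
    calc A * B = (A * C * A) * B := by rw [c1]
      _ = (A * C)ᵀ * (A * B)ᵀ := by rw [b3, c3]; simp only [Matrix.mul_assoc]
      _ = (A * B * A * C)ᵀ := by rw [← Matrix.transpose_mul]; simp only [Matrix.mul_assoc]
      _ = A * C := by rw [b1, c3]
  have h2 : B * A = C * A := by
    calc B * A = B * (A * C * A) := by rw [c1]
      _ = (B * A)ᵀ * (C * A)ᵀ := by rw [b4, c4]; simp only [Matrix.mul_assoc]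
      _ = (C * (A * B * A))ᵀ := by rw [← Matrix.transpose_mul]; simp only [Matrix.mul_assoc]
      _ = C * A := by rw [b1, c4]
  calc B = B * A * B := b2.symm
    _ = C * (A * B) := by rw [h2, Matrix.mul_assoc]
    _ = C := by rw [h1, ← Matrix.mul_assoc, c2]

lemma IsMPInv.transpose {α β : Type*} [Fintype α] [Fintype β]
    {A : Matrix α β ℝ} {B : Matrix β α ℝ} (h : IsMPInv A B) : IsMPInv Aᵀ Bᵀ := by
  obtain ⟨h1, h2, h3, h4⟩ := h
  refine ⟨?_, ?_, ?_, ?_⟩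
  · rw [← Matrix.transpose_mul, ← Matrix.transpose_mul, ← Matrix.mul_assoc, h1]
  · rw [← Matrix.transpose_mul, ← Matrix.transpose_mul, ← Matrix.mul_assoc, h2]
  · rw [← Matrix.transpose_mul, h4, h4]
  · rw [← Matrix.transpose_mul, h3, h3]

lemma IsMPInv.of_smul {α β : Type*} [Fintype α] [Fintype β]
    {A : Matrix α β ℝ} {B : Matrix β α ℝ} {c : ℝ} (hc : c ≠ 0) (h : IsMPInv (c • A) B) :
    IsMPInv A (c • B) := by
  obtain ⟨h1, h2, h3, h4⟩ := h
  simp only [Matrix.smul_mul, Matrix.mul_smul] at h1 h2 h3 h4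
  refine ⟨?_, ?_, ?_, ?_⟩
  · simp only [Matrix.smul_mul, Matrix.mul_smul]
    exact smul_right_injective _ hc h1
  · simp only [Matrix.smul_mul, Matrix.mul_smul]
    rw [h2]
  · simpa only [Matrix.smul_mul, Matrix.mul_smul] using h3
  · simpa only [Matrix.smul_mul, Matrix.mul_smul] using h4

lemma vnorm_eq_norm {n : Type*} [Fintype n] (x : n → ℝ) : vnorm x = ‖WithLp.toLp 2 x‖ := by
  simp [vnorm, EuclideanSpace.norm_eq]

lemma vnorm_nonneg {n : Type*} [Fintype n] (x : n → ℝ) : 0 ≤ vnorm x := Real.sqrt_nonneg _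

lemma vnorm_smul {n : Type*} [Fintype n] (c : ℝ) (x : n → ℝ) :
    vnorm (c • x) = |c| * vnorm x := by
  rw [vnorm_eq_norm, vnorm_eq_norm, WithLp.toLp_smul, norm_smul, Real.norm_eq_abs]

lemma vnorm_neg {n : Type*} [Fintype n] (x : n → ℝ) : vnorm (-x) = vnorm x := by
  simp [vnorm]

lemma vnorm_add_le {n : Type*} [Fintype n] (x y : n → ℝ) :
    vnorm (x + y) ≤ vnorm x + vnorm y := by
  simp only [vnorm_eq_norm, WithLp.toLp_add]
  exact norm_add_le _ _

lemma eq_zero_of_vnorm_eq_zero {n : Type*} [Fintype n] {x : n → ℝ} (h : vnorm x = 0) :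
    x = 0 := by
  rw [vnorm_eq_norm, norm_eq_zero] at h
  simpa using h

lemma exists_vnorm_one_smul {n : Type*} [Fintype n] {x : n → ℝ} (hx : x ≠ 0) :
    ∃ y : n → ℝ, vnorm y = 1 ∧ x = vnorm x • y := by
  have h : vnorm x ≠ 0 := fun h => hx (eq_zero_of_vnorm_eq_zero h)
  refine ⟨(vnorm x)⁻¹ • x, ?_, ?_⟩
  · rw [vnorm_smul, abs_of_nonneg (inv_nonneg.2 (vnorm_nonneg x)), inv_mul_cancel₀ h]
  · rw [smul_smul, mul_inv_cancel₀ h, one_smul]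

lemma continuous_vnorm {n : Type*} [Fintype n] : Continuous (vnorm : (n → ℝ) → ℝ) := by
  unfold vnorm
  fun_prop

lemma isOpen_vball {n : Type*} [Fintype n] (x : n → ℝ) (r : ℝ) : IsOpen (vball x r) :=
  isOpen_lt (continuous_vnorm.comp (continuous_id.sub continuous_const)) continuous_const

/-- A matrix is bounded by its Frobenius norm. -/
lemma vnorm_mulVec_le {p q : Type*} [Fintype p] [Fintype q] (A : Matrix p q ℝ) (x : q → ℝ) :
    vnorm (A *ᵥ x) ≤ Real.sqrt (∑ i, ∑ j, A i j ^ 2) * vnorm x := by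
  unfold vnorm
  rw [← Real.sqrt_mul (Finset.sum_nonneg fun i _ => Finset.sum_nonneg fun j _ => sq_nonneg (A i j))]
  apply Real.sqrt_le_sqrt
  rw [Finset.sum_mul]
  exact Finset.sum_le_sum fun i _ => Finset.sum_mul_sq_le_sq_mul_sq _ _ _

lemma vnorm_mulVec_le_of_abs_le {m k : ℕ} {E : Matrix (Fin m) (Fin k) ℝ} {c : ℝ} (hc : 0 ≤ c)
    (h : ∀ i j, |E i j| ≤ c) (x : Fin k → ℝ) :
    vnorm (E *ᵥ x) ≤ Real.sqrt (m * k) * c * vnorm x := by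
  refine (vnorm_mulVec_le E x).trans (mul_le_mul_of_nonneg_right ?_ (vnorm_nonneg x))
  have h1 : ∑ i, ∑ j, E i j ^ 2 ≤ (m * k) * c ^ 2 := by
    calc ∑ i, ∑ j, E i j ^ 2 ≤ ∑ _i : Fin m, ∑ _j : Fin k, c ^ 2 :=
          Finset.sum_le_sum fun i _ => Finset.sum_le_sum fun j _ => sq_le_sq'
            (by linarith [neg_abs_le (E i j), h i j]) ((le_abs_self _).trans (h i j))
      _ = (m * k) * c ^ 2 := by simp [mul_assoc]
  refine (Real.sqrt_le_sqrt h1).trans ?_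
  rw [Real.sqrt_mul (by positivity), Real.sqrt_sq hc]

lemma vnorm_mulVec_le_opNorm {p q : Type*} [Fintype p] [Fintype q] (A : Matrix p q ℝ)
    (x : q → ℝ) : vnorm (A *ᵥ x) ≤ opNorm A * vnorm x := by
  by_cases hx : x = 0
  · subst hx
    simp [vnorm]
  obtain ⟨y, hy, hxy⟩ := exists_vnorm_one_smul hx
  have hb : vnorm (A *ᵥ y) ≤ opNorm A := by
    refine le_csSup ⟨Real.sqrt (∑ i, ∑ j, A i j ^ 2), ?_⟩ ⟨y, hy, rfl⟩
    rintro _ ⟨z, hz, rfl⟩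
    simpa [hz] using vnorm_mulVec_le A z
  have h : vnorm (A *ᵥ x) = vnorm x * vnorm (A *ᵥ y) := by
    conv_lhs => rw [hxy, Matrix.mulVec_smul, vnorm_smul, abs_of_nonneg (vnorm_nonneg x)]
  rw [h, mul_comm]
  exact mul_le_mul_of_nonneg_right hb (vnorm_nonneg x)

lemma opNorm_nonneg {p q : Type*} [Fintype p] [Fintype q] (A : Matrix p q ℝ) : 0 ≤ opNorm A := by
  apply Real.sSup_nonneg
  rintro _ ⟨x, -, rfl⟩
  exact vnorm_nonneg _

lemma vnorm_mcol_le_mradius {n m : Type*} [Fintype n] [Finite m] (S : Matrix n m ℝ) (j : m) :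
    vnorm (mcol S j) ≤ mradius S :=
  le_ciSup (f := fun j => vnorm (mcol S j)) (Set.finite_range _).bddAbove j

lemma abs_apply_le_vnorm {n : Type*} [Fintype n] (x : n → ℝ) (i : n) : |x i| ≤ vnorm x := by
  unfold vnorm
  rw [← Real.sqrt_sq_eq_abs]
  exact Real.sqrt_le_sqrt
    (Finset.single_le_sum (f := fun i => x i ^ 2) (fun i _ => sq_nonneg _) (Finset.mem_univ i))

lemma abs_cubic_form_le {n : Type*} [Fintype n] (T : n → n → n → ℝ) (u : n → ℝ) :
    |∑ i, ∑ j, ∑ k, T i j k * u i * u j * u k| ≤ t3norm T * vnorm u ^ 3 := by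
  by_cases hu : u = 0
  · subst hu
    simp [vnorm]
  obtain ⟨y, hy, huy⟩ := exists_vnorm_one_smul hu
  have hb : |∑ i, ∑ j, ∑ k, T i j k * y i * y j * y k| ≤ t3norm T := by
    refine le_csSup ⟨∑ i, ∑ j, ∑ k, |T i j k|, ?_⟩ ⟨y, y, y, hy, hy, hy, rfl⟩
    rintro _ ⟨a, b, c, ha, hb, hc, rfl⟩
    refine (Finset.abs_sum_le_sum_abs _ _).trans (Finset.sum_le_sum fun i _ => ?_)
    refine (Finset.abs_sum_le_sum_abs _ _).trans (Finset.sum_le_sum fun j _ => ?_)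
    refine (Finset.abs_sum_le_sum_abs _ _).trans (Finset.sum_le_sum fun k _ => ?_)
    have h1 := (abs_apply_le_vnorm a i).trans_eq ha
    have h2 := (abs_apply_le_vnorm b j).trans_eq hb
    have h3 := (abs_apply_le_vnorm c k).trans_eq hc
    rw [abs_mul, abs_mul, abs_mul]
    calc |T i j k| * |a i| * |b j| * |c k| ≤ |T i j k| * 1 * 1 * 1 := by gcongr
      _ = |T i j k| := by ring
  have h : ∑ i, ∑ j, ∑ k, T i j k * u i * u j * u k
      = vnorm u ^ 3 * ∑ i, ∑ j, ∑ k, T i j k * y i * y j * y k := by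
    have hi : ∀ i, u i = vnorm u * y i := fun i => congrFun huy i
    simp only [Finset.mul_sum]
    refine Finset.sum_congr rfl fun i _ => Finset.sum_congr rfl fun j _ =>
      Finset.sum_congr rfl fun k _ => ?_
    rw [hi i, hi j, hi k]
    ring
  rw [h, abs_mul, abs_of_nonneg (pow_nonneg (vnorm_nonneg u) 3), mul_comm]
  exact mul_le_mul_of_nonneg_right hb (pow_nonneg (vnorm_nonneg u) 3)

/-- Integrating a power bound on the derivative. -/
lemma abs_le_pow_succ_of_abs_deriv_le {h h' : ℝ → ℝ} {c : ℝ} {p : ℕ} (h0 : h 0 = 0)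
    (hd : ∀ r ∈ Set.Icc (0 : ℝ) 1, HasDerivAt h (h' r) r)
    (hb : ∀ r ∈ Set.Icc (0 : ℝ) 1, |h' r| ≤ c * r ^ p) :
    ∀ r ∈ Set.Icc (0 : ℝ) 1, |h r| ≤ c / (p + 1) * r ^ (p + 1) := by
  intro r hr
  have hB : ∀ x : ℝ, HasDerivAt (fun x : ℝ => c / (p + 1) * x ^ (p + 1)) (c * x ^ p) x := by
    intro x
    refine ((hasDerivAt_pow (p + 1) x).const_mul (c / ((p : ℝ) + 1))).congr_deriv ?_
    have : (p : ℝ) + 1 ≠ 0 := by positivity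
    push_cast
    field_simp
  exact image_norm_le_of_norm_deriv_right_le_deriv_boundary
    (fun x hx => (hd x hx).continuousAt.continuousWithinAt)
    (fun x hx => (hd x ⟨hx.1, hx.2.le⟩).hasDerivWithinAt)
    (by simp [h0]) hB (fun x hx => hb x ⟨hx.1, hx.2.le⟩) hr

lemma hasDerivAt_along_line {n : ℕ} {g : (Fin n → ℝ) → ℝ} {x u : Fin n → ℝ} {r : ℝ}
    (hg : DifferentiableAt ℝ g (x + r • u)) :
    HasDerivAt (fun r : ℝ => g (x + r • u))
      (∑ i, fderiv ℝ g (x + r • u) (Pi.single i 1) * u i) r := by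
  have h1 : HasDerivAt (fun r : ℝ => x + r • u) u r := by
    simpa using ((hasDerivAt_id r).smul_const u).const_add x
  refine (hg.hasFDerivAt.comp_hasDerivAt r h1).congr_deriv ?_
  have h3 : fderiv ℝ g (x + r • u) u = fderiv ℝ g (x + r • u) (∑ i, u i • Pi.single i (1 : ℝ)) := by
    rw [← pi_eq_sum_univ']
  rw [h3, map_sum]
  refine Finset.sum_congr rfl fun i _ => ?_
  rw [map_smul, smul_eq_mul, mul_comm]

lemma ContDiffOn.fderiv_apply_const {n : ℕ} {g : (Fin n → ℝ) → ℝ} {U : Set (Fin n → ℝ)}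
    (hU : IsOpen U) {p : ℕ} (hg : ContDiffOn ℝ (p + 1 : ℕ) g U) (v : Fin n → ℝ) :
    ContDiffOn ℝ p (fun y => fderiv ℝ g y v) U :=
  (hg.fderiv_of_isOpen hU (by norm_cast)).clm_apply contDiffOn_const

/-- The second central difference along `u` approximates the Hessian form to fourth order. -/
lemma abs_second_central_difference_sub_le {n : ℕ} {f : (Fin n → ℝ) → ℝ} {x : Fin n → ℝ}
    {R L : ℝ} (hf : ContDiffOn ℝ 4 f (vball x R))
    (hlip : ∀ y ∈ vcball x R, ∀ z ∈ vcball x R,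
      t3norm (fun i j a => d3 f y i j a - d3 f z i j a) ≤ L * vnorm (y - z))
    {u : Fin n → ℝ} (hu : vnorm u < R) :
    |f (x + u) + f (x - u) - 2 * f x - u ⬝ᵥ hess f x *ᵥ u| ≤ L / 12 * vnorm u ^ 4 := by
  have hU := isOpen_vball x R
  have hmem : ∀ v : Fin n → ℝ, vnorm v = vnorm u → ∀ r ∈ Set.Icc (0 : ℝ) 1,
      x + r • v ∈ vball x R := by
    intro v hv r hr
    have : vnorm (r • v) < R := by
      rw [vnorm_smul, abs_of_nonneg hr.1, hv]
      exact (mul_le_of_le_one_left (vnorm_nonneg u) hr.2).trans_lt hu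
    simpa [vball] using this
  have hf1 : ∀ k, ContDiffOn ℝ (3 : ℕ) (fun y => fderiv ℝ f y (Pi.single k 1)) (vball x R) :=
    fun k => ContDiffOn.fderiv_apply_const hU (p := 3) (by exact_mod_cast hf) _
  have hf2 : ∀ j k, ContDiffOn ℝ (2 : ℕ)
      (fun z => fderiv ℝ (fun y => fderiv ℝ f y (Pi.single k 1)) z (Pi.single j 1))
      (vball x R) :=
    fun j k => ContDiffOn.fderiv_apply_const hU (p := 2) (hf1 k) _
  have hdiff : ∀ {p : ℕ} {g : (Fin n → ℝ) → ℝ}, p ≠ 0 → ContDiffOn ℝ p g (vball x R) →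
      ∀ y ∈ vball x R, DifferentiableAt ℝ g y := by
    intro p g hp hg y hy
    exact (hg.differentiableOn (by exact_mod_cast hp)).differentiableAt (hU.mem_nhds hy)
  let A1 : (Fin n → ℝ) → ℝ → ℝ := fun v r =>
    ∑ k, fderiv ℝ f (x + r • v) (Pi.single k 1) * v k
  let A2 : (Fin n → ℝ) → ℝ → ℝ := fun v r => ∑ k, (∑ j, hess f (x + r • v) j k * v j) * v k
  let A3 : (Fin n → ℝ) → ℝ → ℝ := fun v r =>
    ∑ k, (∑ j, (∑ i, d3 f (x + r • v) i j k * v i) * v j) * v k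
  have hA0 : ∀ v : Fin n → ℝ, vnorm v = vnorm u → ∀ r ∈ Set.Icc (0 : ℝ) 1,
      HasDerivAt (fun r : ℝ => f (x + r • v)) (A1 v r) r := fun v hv r hr =>
    hasDerivAt_along_line (hdiff (p := 4) (by norm_num) (by exact_mod_cast hf) _ (hmem v hv r hr))
  have hA1 : ∀ v : Fin n → ℝ, vnorm v = vnorm u → ∀ r ∈ Set.Icc (0 : ℝ) 1,
      HasDerivAt (A1 v) (A2 v r) r := fun v hv r hr =>
    HasDerivAt.fun_sum fun k _ => HasDerivAt.mul_const
      (hasDerivAt_along_line (hdiff (by norm_num) (hf1 k) _ (hmem v hv r hr))) _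
  have hA2 : ∀ v : Fin n → ℝ, vnorm v = vnorm u → ∀ r ∈ Set.Icc (0 : ℝ) 1,
      HasDerivAt (A2 v) (A3 v r) r := fun v hv r hr =>
    HasDerivAt.fun_sum fun k _ => HasDerivAt.mul_const
      (HasDerivAt.fun_sum fun j _ => HasDerivAt.mul_const
        (hasDerivAt_along_line (hdiff (by norm_num) (hf2 j k) _ (hmem v hv r hr))) _) _
  have hn : vnorm (-u) = vnorm u := vnorm_neg u
  set q := u ⬝ᵥ hess f x *ᵥ u with hq
  have hq2 : q = ∑ k, (∑ j, hess f x j k * u j) * u k := by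
    rw [hq, Matrix.dotProduct_mulVec]
    simp [dotProduct, Matrix.vecMul, mul_comm]
  have hA20 : A2 u 0 = q := by simp [A2, hq2]
  have hA20' : A2 (-u) 0 = q := by simp [A2, hq2]
  have hA10 : A1 u 0 + A1 (-u) 0 = 0 := by simp [A1]
  have b3 : ∀ r ∈ Set.Icc (0 : ℝ) 1,
      |A3 u r + A3 (-u) r| ≤ 2 * L * vnorm u ^ 4 * r ^ 1 := by
    intro r hr
    have e : A3 u r + A3 (-u) r = ∑ i, ∑ j, ∑ k,
        (d3 f (x + r • u) i j k - d3 f (x + r • (-u)) i j k) * u i * u j * u k := by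
      have h3 : ∀ F : Fin n → Fin n → Fin n → ℝ,
          ∑ i, ∑ j, ∑ k, F i j k = ∑ k, ∑ j, ∑ i, F i j k := by
        intro F
        rw [Finset.sum_comm]
        simp_rw [Finset.sum_comm (s := Finset.univ (α := Fin n)) (f := fun i k => F i _ k)]
        rw [Finset.sum_comm]
      rw [h3]
      simp only [A3, Finset.sum_mul, ← Finset.sum_add_distrib]
      refine Finset.sum_congr rfl fun i _ => Finset.sum_congr rfl fun j _ =>
        Finset.sum_congr rfl fun k _ => ?_
      simp only [Pi.neg_apply]
      ring
    have hsub : ∀ y ∈ vball x R, y ∈ vcball x R := fun y hy => (show vnorm (y - x) < R from hy).le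
    have hl := hlip _ (hsub _ (hmem u rfl r hr)) _ (hsub _ (hmem (-u) hn r hr))
    have hd : (x + r • u) - (x + r • (-u)) = (2 * r) • u := by
      ext i
      simp
      ring
    rw [hd, vnorm_smul, abs_of_nonneg (by linarith [hr.1])] at hl
    rw [e]
    refine (abs_cubic_form_le _ u).trans ?_
    refine (mul_le_mul_of_nonneg_right hl (pow_nonneg (vnorm_nonneg u) 3)).trans_eq ?_
    ring
  have b2 := abs_le_pow_succ_of_abs_deriv_le (h := fun r => A2 u r + A2 (-u) r - 2 * q)
    (by simp only [hA20, hA20']; ring)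
    (fun r hr => ((hA2 u rfl r hr).add (hA2 (-u) hn r hr)).sub_const (2 * q)) b3
  have b1 := abs_le_pow_succ_of_abs_deriv_le
    (h := fun r => A1 u r + A1 (-u) r - 2 * q * r)
    (by simp only [hA10]; ring)
    (fun r hr => by
      have := ((hA1 u rfl r hr).add (hA1 (-u) hn r hr)).sub
        ((hasDerivAt_id r).const_mul (2 * q))
      rw [mul_one] at this
      exact this) b2
  have b0 := abs_le_pow_succ_of_abs_deriv_le
    (h := fun r : ℝ => f (x + r • u) + f (x + r • (-u)) - 2 * f x - q * r ^ 2)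
    (by simp; ring)
    (fun r hr => by
      refine ((((hA0 u rfl r hr).add (hA0 (-u) hn r hr)).sub_const (2 * f x)).sub
        ((hasDerivAt_pow 2 r).const_mul q)).congr_deriv ?_
      push_cast
      ring) b1 1 ⟨zero_le_one, le_rfl⟩
  simp only [one_smul, one_pow, mul_one, ← sub_eq_add_neg] at b0
  refine b0.trans_eq ?_
  push_cast
  ring

lemma hess_transpose {n : ℕ} {f : (Fin n → ℝ) → ℝ} {x : Fin n → ℝ} (hf : ContDiffAt ℝ 4 f x) :
    (hess f x)ᵀ = hess f x := by
  have hd : DifferentiableAt ℝ (fderiv ℝ f) x :=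
    (hf.fderiv_right (m := 1) (by norm_num)).differentiableAt (by norm_num)
  have e : ∀ i j, hess f x i j = fderiv ℝ (fderiv ℝ f) x (Pi.single i 1) (Pi.single j 1) := by
    intro i j
    simp only [hess, Matrix.of_apply]
    rw [fderiv_clm_apply hd (differentiableAt_const _)]
    simp
  ext i j
  rw [Matrix.transpose_apply, e, e]
  exact (hf.isSymmSndFDerivAt (by simp; norm_num)).eq _ _

/-- The entries of the centered second difference, before the pseudoinverses are applied. -/
def centeredDiff {n m k : ℕ} (f : (Fin n → ℝ) → ℝ) (x : Fin n → ℝ)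
    (S : Matrix (Fin n) (Fin m) ℝ) (T : Matrix (Fin n) (Fin k) ℝ) : Matrix (Fin m) (Fin k) ℝ :=
  Matrix.of fun i j => 2⁻¹ *
    ((f (x + mcol S i + mcol T j) - f (x + mcol S i) - (f (x + mcol T j) - f x)) +
      (f (x - mcol S i - mcol T j) - f (x - mcol S i) - (f (x - mcol T j) - f x)))

lemma gsh_eq {n m k : ℕ} (f : (Fin n → ℝ) → ℝ) (x : Fin n → ℝ)
    (S Sp : Matrix (Fin n) (Fin m) ℝ) (T Tp : Matrix (Fin n) (Fin k) ℝ) :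
    gsh f x S Sp (fun _ => T) (fun _ => Tp) = Sp * (Matrix.of (fun i j =>
      f (x + mcol S i + mcol T j) - f (x + mcol S i) - (f (x + mcol T j) - f x)) * Tpᵀ) := by
  unfold gsh
  congr 1
  ext i j
  simp only [delta2s, gsg, deltas, Matrix.of_apply, Matrix.mul_apply, Matrix.transpose_apply,
    Matrix.mulVec, dotProduct, ← Finset.sum_sub_distrib]
  exact Finset.sum_congr rfl fun a _ => by ring

lemma gcsh_eq {n m k : ℕ} (f : (Fin n → ℝ) → ℝ) (x : Fin n → ℝ)
    (S Sp : Matrix (Fin n) (Fin m) ℝ) (T Tp : Matrix (Fin n) (Fin k) ℝ) :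
    gcsh f x S Sp (fun _ => T) (fun _ => Tp) = Sp * centeredDiff f x S T * Tpᵀ := by
  have hneg : ∀ {p : ℕ} (A : Matrix (Fin n) (Fin p) ℝ) (j : Fin p),
      mcol (-A) j = -mcol A j := fun A j => rfl
  rw [gcsh, gsh_eq, gsh_eq, Matrix.transpose_neg, Matrix.mul_neg, Matrix.mul_neg, Matrix.neg_mul,
    neg_neg, ← Matrix.mul_add, ← Matrix.add_mul, ← Matrix.mul_smul, ← Matrix.smul_mul,
    ← Matrix.mul_assoc]
  have hE : (2⁻¹ : ℝ) • ((Matrix.of fun i j =>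
        f (x + mcol S i + mcol T j) - f (x + mcol S i) - (f (x + mcol T j) - f x)) +
      Matrix.of fun i j =>
        f (x + mcol (-S) i + mcol (-T) j) - f (x + mcol (-S) i) - (f (x + mcol (-T) j) - f x))
      = centeredDiff f x S T := by
    ext i j
    simp only [hneg, centeredDiff, Matrix.of_apply, Matrix.smul_apply, Matrix.add_apply,
      smul_eq_mul, ← sub_eq_add_neg]
  rw [hE]

theorem gcsh_error_bound_commonT {n m k : ℕ}
    (f : (Fin n → ℝ) → ℝ) (x0 : Fin n → ℝ) (Δbar L : ℝ)
    (S Sp Shp : Matrix (Fin n) (Fin m) ℝ)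
    (T Tp : Matrix (Fin n) (Fin k) ℝ)
    (Td Thp : Matrix (Fin k) (Fin n) ℝ)
    (hSp : IsMPInv Sᵀ Sp)
    (hTp : IsMPInv Tᵀ Tp)
    (hTd : IsMPInv T Td)
    (hShp : IsMPInv ((mradius S)⁻¹ • S)ᵀ Shp)
    (hThp : IsMPInv ((mradius T)⁻¹ • T) Thp)
    (hΔbar : 0 < Δbar)
    (hf : ContDiffOn ℝ 4 f (vball x0 Δbar))
    (hL : 0 ≤ L)
    (hlip : ∀ x ∈ vcball x0 Δbar, ∀ y ∈ vcball x0 Δbar,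
      t3norm (fun i j a => d3 f x i j a - d3 f y i j a) ≤ L * vnorm (x - y))
    (hΔS : 0 < mradius S)
    (hΔT : 0 < mradius T)
    (hball₁ : ∀ i, vcball (x0 + mcol S i) (mradius T) ⊆ vball x0 Δbar)
    (hball₂ : ∀ i, vcball (x0 - mcol S i) (mradius T) ⊆ vball x0 Δbar)
    (hball₃ : vcball x0 (mradius T) ⊆ vball x0 Δbar) :
    opNorm (gcsh f x0 S Sp (fun _ => T) (fun _ => Tp)
        - Sp * Sᵀ * hess f x0 * T * Td)
      ≤ 2 * Real.sqrt (m * k) * L *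
        (max (mradius S) (mradius T) / min (mradius S) (mradius T)) *
        opNorm Shp * opNorm Thp * max (mradius S) (mradius T) ^ 2 := by
  set M := max (mradius S) (mradius T) with hM
  have hMpos : 0 < M := lt_max_of_lt_left hΔS
  have hSp' : Sp = (mradius S)⁻¹ • Shp :=
    hSp.unique (IsMPInv.of_smul (inv_ne_zero hΔS.ne') (by simpa using hShp))
  have hTd' : Td = (mradius T)⁻¹ • Thp :=
    hTd.unique (IsMPInv.of_smul (inv_ne_zero hΔT.ne') hThp)
  have hTp' : Tp = Tdᵀ := hTp.unique hTd.transpose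
  set E := centeredDiff f x0 S T - Sᵀ * hess f x0 * T with hE
  have hEq : gcsh f x0 S Sp (fun _ => T) (fun _ => Tp) - Sp * Sᵀ * hess f x0 * T * Td
      = Sp * E * Td := by
    rw [gcsh_eq, hTp', Matrix.transpose_transpose, hE, Matrix.mul_sub, Matrix.sub_mul]
    simp only [Matrix.mul_assoc]
  have hx0 : x0 ∈ vball x0 Δbar := by simpa [vball, vnorm] using hΔbar
  have hsymm := hess_transpose (hf.contDiffAt ((isOpen_vball x0 Δbar).mem_nhds hx0))
  have hEb : ∀ i j, |E i j| ≤ 2 * L * M ^ 4 := by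
    intro i j
    have hs : vnorm (mcol S i) ≤ M := (vnorm_mcol_le_mradius S i).trans (le_max_left _ _)
    have htT := vnorm_mcol_le_mradius T j
    have ht : vnorm (mcol T j) ≤ M := htT.trans (le_max_right _ _)
    have hst : vnorm (mcol S i + mcol T j) ≤ 2 * M := (vnorm_add_le _ _).trans (by linarith)
    have ms : vnorm (mcol S i) < Δbar := by
      have : x0 + mcol S i ∈ vball x0 Δbar := hball₁ i (by simpa [vcball, vnorm] using hΔT.le)
      simpa [vball] using this
    have mt : vnorm (mcol T j) < Δbar := by
      have : x0 + mcol T j ∈ vball x0 Δbar := hball₃ (by simpa [vcball] using htT)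
      simpa [vball] using this
    have mst : vnorm (mcol S i + mcol T j) < Δbar := by
      have : x0 + mcol S i + mcol T j ∈ vball x0 Δbar := hball₁ i (by simpa [vcball] using htT)
      simpa [vball, add_assoc] using this
    have gs := abs_second_central_difference_sub_le hf hlip ms
    have gt := abs_second_central_difference_sub_le hf hlip mt
    have gst := abs_second_central_difference_sub_le hf hlip mst
    have ps : L / 12 * vnorm (mcol S i) ^ 4 ≤ L / 12 * M ^ 4 := by
      gcongr
      exact vnorm_nonneg _
    have pt : L / 12 * vnorm (mcol T j) ^ 4 ≤ L / 12 * M ^ 4 := by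
      gcongr
      exact vnorm_nonneg _
    have pst : L / 12 * vnorm (mcol S i + mcol T j) ^ 4 ≤ L / 12 * (2 * M) ^ 4 := by
      gcongr
      exact vnorm_nonneg _
    have hcomm : mcol T j ⬝ᵥ hess f x0 *ᵥ mcol S i = mcol S i ⬝ᵥ hess f x0 *ᵥ mcol T j := by
      rw [Matrix.dotProduct_mulVec, ← Matrix.mulVec_transpose, hsymm, dotProduct_comm]
    have hEij : (Sᵀ * hess f x0 * T) i j = mcol S i ⬝ᵥ hess f x0 *ᵥ mcol T j := by
      rw [Matrix.mul_assoc]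
      rfl
    have hL4 : 0 ≤ L * M ^ 4 := by positivity
    rw [Matrix.mulVec_add, add_dotProduct, dotProduct_add, dotProduct_add, hcomm, ← add_assoc] at gst
    rw [hE, Matrix.sub_apply, hEij, centeredDiff, Matrix.of_apply,
      sub_sub x0 (mcol S i) (mcol T j)]
    have gs' := abs_le.1 (gs.trans ps)
    have gt' := abs_le.1 (gt.trans pt)
    have gst' := abs_le.1 (gst.trans pst)
    rw [abs_le]
    constructor <;> linarith [gs'.1, gs'.2, gt'.1, gt'.2, gst'.1, gst'.2]
  have hprod : mradius S * mradius T = M * min (mradius S) (mradius T) := by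
    rw [hM, max_mul_min]
  have hmin : 0 < min (mradius S) (mradius T) := lt_min hΔS hΔT
  have h1 := opNorm_nonneg Shp
  have h2 := opNorm_nonneg Thp
  rw [hEq]
  refine Real.sSup_le ?_ (by positivity)
  rintro _ ⟨x, hx, rfl⟩
  rw [← Matrix.mulVec_mulVec, ← Matrix.mulVec_mulVec, hSp', hTd', Matrix.smul_mulVec,
    Matrix.smul_mulVec, Matrix.mulVec_smul, Matrix.mulVec_smul, vnorm_smul, vnorm_smul,
    abs_of_pos (inv_pos.2 hΔS), abs_of_pos (inv_pos.2 hΔT)]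
  have hT' := vnorm_mulVec_le_opNorm Thp x
  rw [hx, mul_one] at hT'
  have key : vnorm (Shp *ᵥ (E *ᵥ (Thp *ᵥ x)))
      ≤ opNorm Shp * (Real.sqrt (m * k) * (2 * L * M ^ 4) * opNorm Thp) := by
    refine (vnorm_mulVec_le_opNorm Shp _).trans (mul_le_mul_of_nonneg_left ?_ h1)
    refine (vnorm_mulVec_le_of_abs_le (by positivity) hEb _).trans ?_
    exact mul_le_mul_of_nonneg_left hT' (by positivity)
  calc (mradius S)⁻¹ * ((mradius T)⁻¹ * vnorm (Shp *ᵥ (E *ᵥ (Thp *ᵥ x))))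
      ≤ (mradius S)⁻¹ * ((mradius T)⁻¹ *
          (opNorm Shp * (Real.sqrt (m * k) * (2 * L * M ^ 4) * opNorm Thp))) := by gcongr
    _ = (mradius S * mradius T)⁻¹ *
          (opNorm Shp * (Real.sqrt (m * k) * (2 * L * M ^ 4) * opNorm Thp)) := by
        rw [mul_inv, mul_assoc (mradius S)⁻¹]
    _ = _ := by
        rw [hprod]
        field_simp
end
end

section
/- Let f : ℝⁿ → ℝ, x⁰ ∈ ℝⁿ, S = [s¹ … s^m] ∈ ℝ^{n×m} and T̄ = [t¹ … t^k] ∈ ℝ^{n×k}, with T̄ used as the common inner matrix. Then the transpose of the generalized centered simplex Hessian of f at x⁰ over S and T̄ equals the generalized centered simplex Hessian of f at x⁰ over T̄ and S: (∇²_c f(x⁰;S,T̄))ᵀ = ∇²_c f(x⁰;T̄,S). -/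
open Matrix

noncomputable section

/-- With a common inner matrix, exchanging the two matrices of directions transposes the
generalized simplex Hessian, whatever matrices `Sp` and `Tp` stand for the pseudoinverses. -/
theorem gsh_transpose {n m k : Type*} [Fintype m] [Fintype k]
    (f : (n → ℝ) → ℝ) (x0 : n → ℝ) (S Sp : Matrix n m ℝ) (T Tp : Matrix n k ℝ) :
    (gsh f x0 S Sp (fun _ : m => T) (fun _ => Tp))ᵀ
      = gsh f x0 T Tp (fun _ : k => S) (fun _ => Sp) := by
  ext a b
  simp only [gsh, delta2s, gsg, deltas, Matrix.transpose_apply, Matrix.mul_apply,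
    Matrix.of_apply, Matrix.mulVec, dotProduct, ← Finset.sum_sub_distrib, Finset.mul_sum]
  rw [Finset.sum_comm]
  refine Finset.sum_congr rfl fun j _ => Finset.sum_congr rfl fun i _ => ?_
  rw [add_right_comm x0 (mcol S i) (mcol T j)]
  ring

theorem gcsh_transpose {n m k : ℕ}
    (f : (Fin n → ℝ) → ℝ) (x0 : Fin n → ℝ)
    (S Sp : Matrix (Fin n) (Fin m) ℝ)
    (T Tp : Matrix (Fin n) (Fin k) ℝ)
    (hSp : IsMPInv Sᵀ Sp)
    (hTp : IsMPInv Tᵀ Tp) :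
    (gcsh f x0 S Sp (fun _ : Fin m => T) (fun _ => Tp))ᵀ
      = gcsh f x0 T Tp (fun _ : Fin k => S) (fun _ => Sp) := by
  simp only [gcsh, Matrix.transpose_smul, Matrix.transpose_add, gsh_transpose]
end
end
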